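/- Every finite abelian subgroup G of PGL_2(F) with F an algebraically closed field of characteristic p > 0 is isomorphic to one of: a cyclic group Z/nZ with gcd(n,p)=1, the Klein four-group Z/2Z × Z/2Z (only when p ≠ 2), or an elementary abelian p-group (Z/pZ)^r for some r ≥ 0. -/

import Mathlib

open Matrix

/-- The projective general linear group `PGL₂(F)`. -/
abbrev PGL2 (k : Type*) [Field k] := GL (Fin 2) k ⧸ Subgroup.center (GL (Fin 2) k)

section Matrices

variable {F : Type*} [Field F]

lemma Matrix.exists_roots_fin_two [IsAlgClosed F] (A : Matrix (Fin 2) (Fin 2) F) :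
    ∃ α β : F, A.trace = α + β ∧ A.det = α * β := by
  have hdeg : (Polynomial.X ^ 2 + Polynomial.C (-A.trace) * Polynomial.X
      + Polynomial.C A.det : Polynomial F).degree = 2 := by compute_degree!
  obtain ⟨α, hα⟩ := IsAlgClosed.exists_root _ (by rw [hdeg]; decide)
  refine ⟨α, A.trace - α, by ring, ?_⟩
  simp only [Polynomial.IsRoot.def, Polynomial.eval_add, Polynomial.eval_pow, Polynomial.eval_X,
    Polynomial.eval_mul, Polynomial.eval_C] at hα
  linear_combination hα

/-- The Cayley–Hamilton theorem for a `2 × 2` matrix with eigenvalues `α`, `β`. -/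
lemma Matrix.sub_scalar_mul_sub_scalar_eq_zero {A : Matrix (Fin 2) (Fin 2) F} {α β : F}
    (htr : A.trace = α + β) (hdet : A.det = α * β) : (A - α • 1) * (A - β • 1) = 0 := by
  rw [trace_fin_two] at htr
  rw [det_fin_two] at hdet
  ext i j
  fin_cases i <;> fin_cases j <;> simp [mul_apply, Fin.sum_univ_two, one_apply]
  · linear_combination A 0 0 * htr - hdet
  · linear_combination A 0 1 * htr
  · linear_combination A 1 0 * htr
  · linear_combination A 1 1 * htr - hdet

lemma Matrix.exists_eq_of_commute_fin_two {A B : Matrix (Fin 2) (Fin 2) F}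
    (hA : ∀ c : F, A ≠ c • 1) (h : A * B = B * A) : ∃ x y : F, B = x • 1 + y • A := by
  have e (i j) := congrFun (congrFun h i) j
  have e00 := e 0 0
  have e01 := e 0 1
  have e10 := e 1 0
  simp only [mul_apply, Fin.sum_univ_two] at e00 e01 e10
  suffices h : ∃ y : F, B 0 1 = y * A 0 1 ∧ B 1 0 = y * A 1 0 ∧
      B 0 0 - B 1 1 = y * (A 0 0 - A 1 1) by
    obtain ⟨y, h1, h2, h3⟩ := h
    refine ⟨B 0 0 - y * A 0 0, y, ?_⟩
    ext i j
    fin_cases i <;> fin_cases j <;> simp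
    · exact h1
    · exact h2
    · linear_combination -h3
  by_cases h01 : A 0 1 = 0
  · by_cases h10 : A 1 0 = 0
    · have hd : A 0 0 - A 1 1 ≠ 0 := by
        intro hd
        apply hA (A 0 0)
        ext i j
        fin_cases i <;> fin_cases j <;> simp [h01, h10]
        linear_combination -hd
      refine ⟨(B 0 0 - B 1 1) / (A 0 0 - A 1 1), ?_, ?_, by field_simp⟩
      · rw [h01, mul_zero]
        exact (mul_eq_zero.1 (by rw [h01] at e01; linear_combination e01 :
          (A 0 0 - A 1 1) * B 0 1 = 0)).resolve_left hd
      · rw [h10, mul_zero]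
        exact (mul_eq_zero.1 (by rw [h10] at e10; linear_combination -e10 :
          (A 0 0 - A 1 1) * B 1 0 = 0)).resolve_left hd
    · refine ⟨B 1 0 / A 1 0, ?_, by field_simp, ?_⟩
      · field_simp
        linear_combination -e00
      · field_simp
        linear_combination e10
  · refine ⟨B 0 1 / A 0 1, by field_simp, ?_, ?_⟩
    · field_simp
      linear_combination e00
    · field_simp
      linear_combination -e01

lemma Matrix.commute_up_to_scalar_fin_two {A B : Matrix (Fin 2) (Fin 2) F}
    (hA : A.det ≠ 0) (hB : B.det ≠ 0) {c : F} (h : A * B = c • (B * A)) :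
    c = 1 ∨ (c = -1 ∧ A.trace = 0 ∧ B.trace = 0) := by
  have hc : c ^ 2 = 1 := by
    have := congrArg det h
    rw [det_smul, det_mul, det_mul, Fintype.card_fin] at this
    apply mul_right_cancel₀ (mul_ne_zero hA hB)
    linear_combination -this
  by_cases h1 : c = 1
  · exact Or.inl h1
  have hcn : c = -1 := by
    have : (c - 1) * (c + 1) = 0 := by linear_combination hc
    exact eq_neg_of_add_eq_zero_left ((mul_eq_zero.1 this).resolve_left (sub_ne_zero.2 h1))
  refine Or.inr ⟨hcn, ?_, ?_⟩
  · have e : A = c • (B * A * B⁻¹) := by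
      rw [← smul_mul, ← h, Matrix.mul_assoc, mul_nonsing_inv _ hB.isUnit, Matrix.mul_one]
    have := congrArg trace e
    rw [trace_smul, trace_mul_comm, ← Matrix.mul_assoc, nonsing_inv_mul _ hB.isUnit,
      Matrix.one_mul, smul_eq_mul] at this
    have h2 : (c - 1) * A.trace = 0 := by linear_combination -this
    exact (mul_eq_zero.1 h2).resolve_left (sub_ne_zero.2 h1)
  · have e : A⁻¹ * (A * B) = B := by
      rw [← Matrix.mul_assoc, nonsing_inv_mul _ hA.isUnit, Matrix.one_mul]
    have := congrArg trace e
    rw [h, Matrix.mul_smul, trace_smul, trace_mul_comm, Matrix.mul_assoc,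
      mul_nonsing_inv _ hA.isUnit, Matrix.mul_one, smul_eq_mul] at this
    have h2 : (c - 1) * B.trace = 0 := by linear_combination this
    exact (mul_eq_zero.1 h2).resolve_left (sub_ne_zero.2 h1)

lemma Matrix.sq_eq_neg_det_of_trace_eq_zero {A : Matrix (Fin 2) (Fin 2) F}
    (h : A.trace = 0) : A * A = (-A.det) • 1 := by
  rw [trace_fin_two] at h
  rw [det_fin_two]
  ext i j
  fin_cases i <;> fin_cases j <;> simp [mul_apply, Fin.sum_univ_two]
  · linear_combination A 0 0 * h
  · linear_combination A 0 1 * h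
  · linear_combination A 1 0 * h
  · linear_combination A 1 1 * h

/-- The spectral idempotents of a `2 × 2` matrix with distinct eigenvalues. -/
lemma Matrix.exists_spectral_idempotents_fin_two {A : Matrix (Fin 2) (Fin 2) F} {α β : F}
    (hne : α ≠ β) (htr : A.trace = α + β) (hdet : A.det = α * β) :
    ∃ E₁ E₂ : Matrix (Fin 2) (Fin 2) F, E₁ + E₂ = 1 ∧ A = α • E₁ + β • E₂ ∧
      E₁ * E₁ = E₁ ∧ E₂ * E₂ = E₂ ∧ E₁ * E₂ = 0 ∧ E₂ * E₁ = 0 ∧ E₁.trace = 1 ∧ E₂.trace = 1 := by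
  have hsub : α - β ≠ 0 := sub_ne_zero.2 hne
  have hsum : (α - β)⁻¹ • (A - β • 1) + (-(α - β)⁻¹) • (A - α • 1) = 1 := by
    rw [neg_smul, ← sub_eq_add_neg, ← smul_sub, sub_sub_sub_cancel_left, ← sub_smul, smul_smul,
      inv_mul_cancel₀ hsub, one_smul]
  have h₁₂ := sub_scalar_mul_sub_scalar_eq_zero (by rw [htr, add_comm] : A.trace = β + α)
    (by rw [hdet, mul_comm])
  have h₂₁ := sub_scalar_mul_sub_scalar_eq_zero htr hdet
  have hE₁₂ : ((α - β)⁻¹ • (A - β • 1)) * ((-(α - β)⁻¹) • (A - α • 1)) = 0 := by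
    rw [Matrix.smul_mul, Matrix.mul_smul, h₁₂, smul_zero, smul_zero]
  have hE₂₁ : ((-(α - β)⁻¹) • (A - α • 1)) * ((α - β)⁻¹ • (A - β • 1)) = 0 := by
    rw [Matrix.smul_mul, Matrix.mul_smul, h₂₁, smul_zero, smul_zero]
  refine ⟨_, _, hsum, ?_, ?_, ?_, hE₁₂, hE₂₁, ?_, ?_⟩
  · ext i j
    simp only [add_apply, smul_apply, sub_apply, smul_eq_mul]
    field_simp
    ring
  · nth_rw 2 [eq_sub_of_add_eq hsum]
    rw [Matrix.mul_sub, Matrix.mul_one, hE₁₂, sub_zero]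
  · nth_rw 2 [eq_sub_of_add_eq' hsum]
    rw [Matrix.mul_sub, Matrix.mul_one, hE₂₁, sub_zero]
  · simp only [trace_smul, trace_sub, htr, trace_one, Fintype.card_fin, smul_eq_mul]
    field_simp
    push_cast
    ring
  · simp only [trace_smul, trace_sub, htr, trace_one, Fintype.card_fin, smul_eq_mul]
    field_simp
    push_cast
    ring

end Matrices

section Groups

lemma exists_mulEquiv_of_forall_pow_eq_one {G : Type*} [CommGroup G] [Finite G] (p : ℕ)
    [Fact p.Prime] (h : ∀ g : G, g ^ p = 1) :
    ∃ r : ℕ, Nonempty (G ≃* (Fin r → Multiplicative (ZMod p))) := by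
  let : Module (ZMod p) (Additive G) := AddCommGroup.zmodModule (n := p) h
  have : Module.Finite (ZMod p) (Additive G) := Module.Finite.of_finite
  let e := (Module.finBasis (ZMod p) (Additive G)).equivFun.toAddEquiv
  exact ⟨_, ⟨(AddEquiv.toMultiplicativeRight e).trans (MulEquiv.piMultiplicative _)⟩⟩

lemma isKleinFour_of_generators {G : Type*} [Group G] {a b : G} (ha : a ≠ 1) (hb : b ≠ 1)
    (hab : a ≠ b) (ha2 : a * a = 1) (hb2 : b * b = 1) (hcomm : a * b = b * a)
    (h : ∀ g : G, g = 1 ∨ g = a ∨ g = b ∨ g = a * b) : IsKleinFour G where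
  card_four := by
    classical
    have hu : (Set.univ : Set G) = (({1, a, b, a * b} : Finset G) : Set G) := by
      ext g; simpa using h g
    have hne : a * b ≠ 1 := fun h' => hab (mul_right_cancel (h'.trans hb2.symm))
    rw [← Set.ncard_univ, hu, Set.ncard_coe_finset]
    rw [Finset.card_insert_of_notMem, Finset.card_insert_of_notMem, Finset.card_insert_of_notMem,
      Finset.card_singleton]
    · simpa using ha
    · simpa using ⟨hab, hb⟩
    · simpa using ⟨ha.symm, hb.symm, hne.symm⟩
  exponent_two := by
    refine (Nat.prime_two.eq_one_or_self_of_dvd _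
      (Monoid.exponent_dvd_of_forall_pow_eq_one fun g => ?_)).resolve_left fun h1 => ?_
    · rw [pow_two]
      rcases h g with rfl | rfl | rfl | rfl
      · simp
      · exact ha2
      · exact hb2
      · rw [mul_assoc, ← mul_assoc b, ← hcomm, mul_assoc a, hb2, mul_one, ha2]
    · exact ha (by simpa [h1] using Monoid.pow_exponent_eq_one a)

lemma coprime_card_of_forall_pow_eq_one {G : Type*} [Group G] [Finite G] (p : ℕ)
    [hp : Fact p.Prime] (h : ∀ g : G, g ^ p = 1 → g = 1) : (Nat.card G).Coprime p := by
  refine ((Nat.Prime.coprime_iff_not_dvd hp.out).2 fun hd => ?_).symm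
  obtain ⟨g, hg⟩ := exists_prime_orderOf_dvd_card' p hd
  have h1 := h g (hg ▸ pow_orderOf_eq_one g)
  rw [h1, orderOf_one] at hg
  exact hp.out.ne_one hg.symm

end Groups

section Lifts

variable {F : Type*} [Field F]

namespace PGL2

/-- A matrix representing an element of `PGL₂(F)`. -/
noncomputable def lift (g : PGL2 F) : Matrix (Fin 2) (Fin 2) F := (Quotient.out g).val

lemma det_lift_ne_zero (g : PGL2 F) : (lift g).det ≠ 0 :=
  ((isUnit_iff_isUnit_det _).1 (Quotient.out g).isUnit).ne_zero

lemma mk_eq_mk_iff {g h : GL (Fin 2) F} :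
    (g : PGL2 F) = h ↔ ∃ c : F, h.val = c • g.val := by
  rw [QuotientGroup.eq, GeneralLinearGroup.mem_center_iff_val_mem_range_scalar]
  constructor
  · rintro ⟨c, hc⟩
    refine ⟨c, ?_⟩
    have : h.val = g.val * (g⁻¹ * h).val := by rw [← Units.val_mul, mul_inv_cancel_left]
    rw [this, ← hc, scalar_apply, ← smul_one_eq_diagonal, Matrix.mul_smul, Matrix.mul_one]
  · rintro ⟨c, hc⟩
    refine ⟨c, ?_⟩
    rw [Units.val_mul, hc, Matrix.mul_smul, ← Units.val_mul, inv_mul_cancel, Units.val_one,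
      smul_one_eq_diagonal, scalar_apply]

lemma exists_lift_mul (g h : PGL2 F) : ∃ c : F, lift (g * h) = c • (lift g * lift h) := by
  have : ((Quotient.out g * Quotient.out h : GL (Fin 2) F) : PGL2 F)
      = (Quotient.out (g * h) : GL (Fin 2) F) := by
    rw [QuotientGroup.mk_mul, QuotientGroup.out_eq', QuotientGroup.out_eq', QuotientGroup.out_eq']
  exact mk_eq_mk_iff.1 this

lemma eq_of_lift_eq_smul {g h : PGL2 F} {c : F} (H : lift h = c • lift g) : g = h := by
  have := mk_eq_mk_iff.2 ⟨c, H⟩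
  rwa [QuotientGroup.out_eq', QuotientGroup.out_eq'] at this

lemma exists_lift_one : ∃ c : F, lift (1 : PGL2 F) = c • 1 := by
  have : ((1 : GL (Fin 2) F) : PGL2 F) = (Quotient.out (1 : PGL2 F) : GL (Fin 2) F) := by
    rw [QuotientGroup.out_eq']; rfl
  exact mk_eq_mk_iff.1 this

lemma ne_zero_of_lift_eq_smul {g : PGL2 F} {c : F} {M : Matrix (Fin 2) (Fin 2) F}
    (h : lift g = c • M) : c ≠ 0 := by
  rintro rfl
  apply det_lift_ne_zero g
  simp [h]

lemma eq_one_of_lift_eq_smul_one {g : PGL2 F} {c : F} (h : lift g = c • 1) : g = 1 := by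
  obtain ⟨d, hd⟩ := exists_lift_one (F := F)
  have hc := ne_zero_of_lift_eq_smul h
  refine eq_of_lift_eq_smul (c := d / c) ?_
  rw [h, hd, smul_smul, div_mul_cancel₀ _ hc]

lemma mul_eq_one_of_lift {g h : PGL2 F} {c : F} (H : lift g * lift h = c • 1) : g * h = 1 := by
  obtain ⟨d, hd⟩ := exists_lift_mul g h
  rw [H, smul_smul] at hd
  exact eq_one_of_lift_eq_smul_one hd

lemma exists_lift_pow (g : PGL2 F) (n : ℕ) : ∃ c : F, lift (g ^ n) = c • lift g ^ n := by
  induction n with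
  | zero => simpa using exists_lift_one
  | succ n ih =>
    obtain ⟨c, hc⟩ := ih
    obtain ⟨d, hd⟩ := exists_lift_mul (g ^ n) g
    exact ⟨d * c, by rw [pow_succ, hd, hc, pow_succ, smul_mul, smul_smul]⟩

lemma lift_mul_lift_of_commute {g h : PGL2 F} (H : g * h = h * g) :
    lift g * lift h = lift h * lift g ∨
      (lift g * lift h = -(lift h * lift g) ∧ (lift g).trace = 0 ∧ (lift h).trace = 0) := by
  obtain ⟨c, hc⟩ := exists_lift_mul g h
  obtain ⟨d, hd⟩ := exists_lift_mul h g
  have hc0 := ne_zero_of_lift_eq_smul hc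
  have e : lift g * lift h = (c⁻¹ * d) • (lift h * lift g) := by
    rw [mul_smul, ← hd, ← H, hc, smul_smul, inv_mul_cancel₀ hc0, one_smul]
  rcases commute_up_to_scalar_fin_two (det_lift_ne_zero g) (det_lift_ne_zero h) e with
    h1 | ⟨h1, h2⟩
  · left; rw [e, h1, one_smul]
  · right; exact ⟨by rw [e, h1, neg_one_smul], h2⟩

/-- Elements commuting with a non-trivial unipotent element have order dividing `p`. -/
lemma pow_char_eq_one_of_commute {p : ℕ} [Fact p.Prime] [CharP F p] {a g : PGL2 F} (ha : a ≠ 1)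
    {α : F} (htr : (lift a).trace = α + α) (hdet : (lift a).det = α * α)
    (h : a * g = g * a) : g ^ p = 1 := by
  have hp : p.Prime := Fact.out
  have hcomm : lift a * lift g = lift g * lift a := by
    rcases lift_mul_lift_of_commute h with h1 | ⟨h1, h2, -⟩
    · exact h1
    · have hα : α ≠ 0 := by
        rintro rfl
        exact det_lift_ne_zero a (by simpa using hdet)
      have h20 : (2 : F) = 0 := by
        have : 2 * α = 0 := by linear_combination h2 - htr
        exact (mul_eq_zero.1 this).resolve_right hα
      rw [h1, neg_eq_iff_add_eq_zero, ← two_smul F, h20, zero_smul]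
  obtain ⟨x, y, hxy⟩ := exists_eq_of_commute_fin_two
    (fun c hc => ha (eq_one_of_lift_eq_smul_one hc)) hcomm
  have hN := sub_scalar_mul_sub_scalar_eq_zero htr hdet
  set N := lift a - α • 1 with hNdef
  have hg : lift g = (x + y * α) • 1 + y • N := by
    rw [hxy, hNdef, smul_sub, add_smul, smul_smul]; abel
  obtain ⟨c, hc⟩ := exists_lift_pow g p
  have hNp : N ^ p = 0 := pow_eq_zero_of_le hp.two_le (by rw [pow_two, hN])
  have hpow : lift g ^ p = (x + y * α) ^ p • 1 := by
    rw [hg, add_pow_char_of_commute _ (((Commute.one_left N).smul_left _).smul_right _),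
      smul_pow, smul_pow, hNp, one_pow, smul_zero, add_zero]
  rw [hpow, smul_smul] at hc
  exact eq_one_of_lift_eq_smul_one hc

/-- A subgroup whose representatives commute with one having distinct eigenvalues embeds in the
multiplicative monoid of the field, by the ratio of eigenvalues. -/
lemma exists_injective_hom (G : Subgroup (PGL2 F)) {a : PGL2 F} (ha : a ≠ 1) {α β : F}
    (hne : α ≠ β) (htr : (lift a).trace = α + β) (hdet : (lift a).det = α * β)
    (hcomm : ∀ g : G, lift a * lift g.1 = lift g.1 * lift a) :
    ∃ f : G →* F, Function.Injective f := by
  obtain ⟨E₁, E₂, hsum, hA, h₁₁, h₂₂, h₁₂, h₂₁, htr₁, htr₂⟩ :=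
    exists_spectral_idempotents_fin_two hne htr hdet
  have hex (g : G) : ∃ s t : F, lift g.1 = s • E₁ + t • E₂ := by
    obtain ⟨x, y, hxy⟩ := exists_eq_of_commute_fin_two
      (fun c hc => ha (eq_one_of_lift_eq_smul_one hc)) (hcomm g)
    exact ⟨x + y * α, x + y * β, by rw [hxy, hA, ← hsum]; module⟩
  have hcoef {s t s' t' : F} (h : s • E₁ + t • E₂ = s' • E₁ + t' • E₂) : s = s' ∧ t = t' := by
    constructor
    · simpa [Matrix.add_mul, h₁₁, h₂₁, htr₁] using congrArg (fun M => (M * E₁).trace) h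
    · simpa [Matrix.add_mul, h₁₂, h₂₂, htr₂] using congrArg (fun M => (M * E₂).trace) h
  choose s t hst using hex
  have ht (g : G) : t g ≠ 0 := by
    intro h0
    have h := hst g
    rw [h0, zero_smul, add_zero] at h
    have hz : lift g.1 * E₂ = 0 := by rw [h, Matrix.smul_mul, h₁₂, smul_zero]
    have hE : E₂ = 0 := by
      rw [← Matrix.one_mul E₂, ← nonsing_inv_mul _ (det_lift_ne_zero g.1).isUnit,
        Matrix.mul_assoc, hz, Matrix.mul_zero]
    simp [hE] at htr₂
  refine ⟨⟨⟨fun g => s g / t g, ?_⟩, fun g h => ?_⟩, fun g h H => ?_⟩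
  · obtain ⟨c, hc⟩ := exists_lift_one (F := F)
    have h1 := hst 1
    rw [OneMemClass.coe_one, hc, ← hsum, smul_add] at h1
    obtain ⟨e₁, e₂⟩ := hcoef h1
    rw [← e₁, ← e₂, div_self (ne_zero_of_lift_eq_smul hc)]
  · obtain ⟨c, hc⟩ := exists_lift_mul g.1 h.1
    have hc0 := ne_zero_of_lift_eq_smul hc
    have hm := hst (g * h)
    have hprod : lift g.1 * lift h.1 = (s g * s h) • E₁ + (t g * t h) • E₂ := by
      rw [hst g, hst h]
      simp only [Matrix.add_mul, Matrix.mul_add, Matrix.smul_mul, Matrix.mul_smul, h₁₁, h₁₂, h₂₁,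
        h₂₂, smul_zero, add_zero, zero_add, smul_smul]
      module
    rw [Subgroup.coe_mul, hc, hprod, smul_add, smul_smul, smul_smul] at hm
    obtain ⟨e₁, e₂⟩ := hcoef hm
    change s (g * h) / t (g * h) = s g / t g * (s h / t h)
    rw [← e₁, ← e₂, mul_div_mul_left _ _ hc0, mul_div_mul_comm]
  · change s g / t g = s h / t h at H
    have hg := ht g
    have hh := ht h
    refine Subtype.ext (eq_of_lift_eq_smul (c := t h / t g) ?_)
    rw [hst g, hst h, smul_add, smul_smul, smul_smul, div_mul_cancel₀ _ hg]
    congr 2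
    field_simp at H ⊢
    linear_combination -H

lemma lift_mul_lift_mul {u k g : PGL2 F} {e e' : F} (hk : lift u * lift k = e • (lift k * lift u))
    (hg : lift u * lift g = e' • (lift g * lift u)) :
    lift u * lift (k * g) = (e * e') • (lift (k * g) * lift u) := by
  obtain ⟨c, hc⟩ := exists_lift_mul k g
  rw [hc, Matrix.mul_smul, ← Matrix.mul_assoc, hk, Matrix.smul_mul, Matrix.mul_assoc, hg,
    Matrix.mul_smul, ← Matrix.mul_assoc, Matrix.smul_mul]
  module

/-- Two elements of an abelian subgroup whose representatives anticommute generate it. -/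
lemma isKleinFour_of_anticommute (G : Subgroup (PGL2 F)) (hab : ∀ g h : G, g * h = h * g)
    (h2 : (2 : F) ≠ 0) {a b : G} (h : lift a.1 * lift b.1 = -(lift b.1 * lift a.1))
    (hta : (lift a.1).trace = 0) (htb : (lift b.1).trace = 0) : IsKleinFour G := by
  have hab' (g h : G) : g.1 * h.1 = h.1 * g.1 := congrArg Subtype.val (hab g h)
  have hprod : lift b.1 * lift a.1 ≠ 0 := fun h0 =>
    mul_ne_zero (det_lift_ne_zero b.1) (det_lift_ne_zero a.1) (by rw [← det_mul, h0]; simp)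
  have hself {M : Matrix (Fin 2) (Fin 2) F} (hM : M = -M) : M = 0 := by
    have : (2 : F) • M = 0 := by rw [two_smul]; nth_rw 1 [hM]; exact neg_add_cancel M
    exact (smul_eq_zero.1 this).resolve_left h2
  have hnot : ¬ lift a.1 * lift b.1 = lift b.1 * lift a.1 := fun h' =>
    hprod (hself (h'.symm.trans h))
  have hone {g : PGL2 F} (hg : g = 1) (M) : lift g * M = M * lift g := by
    obtain ⟨c, hc⟩ := exists_lift_one (F := F)
    rw [hg, hc]; simp
  have ha : a ≠ 1 := fun h' => hnot (hone (by rw [h']; rfl) _)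
  have hb : b ≠ 1 := fun h' => hnot (hone (by rw [h']; rfl) _).symm
  have hne : a ≠ b := fun h' => hnot (by rw [h'])
  have ha2 : a * a = 1 :=
    Subtype.ext (mul_eq_one_of_lift (sq_eq_neg_det_of_trace_eq_zero hta))
  have hb2 : b * b = 1 :=
    Subtype.ext (mul_eq_one_of_lift (sq_eq_neg_det_of_trace_eq_zero htb))
  have hcent {g : G} (hga : lift a.1 * lift g.1 = lift g.1 * lift a.1)
      (hgb : lift b.1 * lift g.1 = lift g.1 * lift b.1) : g = 1 := by
    obtain ⟨x, y, hxy⟩ := exists_eq_of_commute_fin_two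
      (fun c hc => ha (Subtype.ext (eq_one_of_lift_eq_smul_one hc))) hga
    have hy : y • (lift b.1 * lift a.1) = 0 := by
      apply hself
      rw [hxy] at hgb
      simp only [Matrix.mul_add, Matrix.add_mul, Matrix.mul_smul, Matrix.smul_mul, Matrix.mul_one,
        Matrix.one_mul, h] at hgb
      rw [← smul_neg]
      exact add_left_cancel hgb
    rw [(smul_eq_zero.1 hy).resolve_right hprod, zero_smul, add_zero] at hxy
    exact Subtype.ext (eq_one_of_lift_eq_smul_one hxy)
  have hself_comm (u : G) : lift u.1 * lift u.1 = (1 : F) • (lift u.1 * lift u.1) :=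
    (one_smul F _).symm
  have h_ab : lift a.1 * lift b.1 = (-1 : F) • (lift b.1 * lift a.1) := by rw [h, neg_one_smul]
  have h_ba : lift b.1 * lift a.1 = (-1 : F) • (lift a.1 * lift b.1) := by
    rw [h, neg_one_smul, neg_neg]
  have hsign (u g : G) : lift u.1 * lift g.1 = (1 : F) • (lift g.1 * lift u.1) ∨
      lift u.1 * lift g.1 = (-1 : F) • (lift g.1 * lift u.1) := by
    rw [one_smul, neg_one_smul]
    exact (lift_mul_lift_of_commute (hab' u g)).imp_right And.left
  have hmul_eq {k g : G} {e₁ e₂ e₃ e₄ : F} (h₁ : lift a.1 * lift k.1 = e₁ • (lift k.1 * lift a.1))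
      (h₂ : lift b.1 * lift k.1 = e₂ • (lift k.1 * lift b.1))
      (h₃ : lift a.1 * lift g.1 = e₃ • (lift g.1 * lift a.1))
      (h₄ : lift b.1 * lift g.1 = e₄ • (lift g.1 * lift b.1))
      (h₁₃ : e₁ * e₃ = 1) (h₂₄ : e₂ * e₄ = 1) : k * g = 1 := by
    apply hcent
    · simpa [h₁₃] using lift_mul_lift_mul h₁ h₃
    · simpa [h₂₄] using lift_mul_lift_mul h₂ h₄
  have ha' : a⁻¹ = a := inv_eq_of_mul_eq_one_left ha2
  have hb' : b⁻¹ = b := inv_eq_of_mul_eq_one_left hb2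
  refine isKleinFour_of_generators ha hb hne ha2 hb2 (hab a b) fun g => ?_
  rcases hsign a g with h₃ | h₃ <;> rcases hsign b g with h₄ | h₄
  · exact Or.inl (hcent (by simpa using h₃) (by simpa using h₄))
  · refine Or.inr (Or.inl ?_)
    rw [← ha']
    exact eq_inv_of_mul_eq_one_right (hmul_eq (hself_comm a) h_ba h₃ h₄ (by simp) (by simp))
  · refine Or.inr (Or.inr (Or.inl ?_))
    rw [← hb']
    exact eq_inv_of_mul_eq_one_right (hmul_eq h_ab (hself_comm b) h₃ h₄ (by simp) (by simp))
  · refine Or.inr (Or.inr (Or.inr ?_))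
    have hinv : (a * b)⁻¹ = a * b := by rw [_root_.mul_inv_rev, ha', hb', hab]
    rw [← hinv]
    exact eq_inv_of_mul_eq_one_right (hmul_eq (lift_mul_lift_mul (hself_comm a) h_ab)
      (lift_mul_lift_mul h_ba (hself_comm b)) h₃ h₄ (by simp) (by simp))

end PGL2

end Lifts

/-- Dickson's classification, abelian part: a finite abelian subgroup of `PGL₂(F)`,
`F` algebraically closed of characteristic `p > 0`, is cyclic of order prime to `p`,
Klein four (only if `p ≠ 2`), or elementary abelian `p`-group. -/
theorem finite_abelian_subgroup_PGL2_classification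
    {F : Type*} [Field F] [IsAlgClosed F] (p : ℕ) [Fact p.Prime] [CharP F p]
    (G : Subgroup (PGL2 F)) [Finite G] (hab : ∀ a b : G, a * b = b * a) :
    (∃ n : ℕ, Nat.Coprime n p ∧ Nonempty (G ≃* Multiplicative (ZMod n))) ∨
    (p ≠ 2 ∧ Nonempty (G ≃* (Multiplicative (ZMod 2) × Multiplicative (ZMod 2)))) ∨
    (∃ r : ℕ, Nonempty (G ≃* (Fin r → Multiplicative (ZMod p)))) := by
  have hab' (g h : G) : g.1 * h.1 = h.1 * g.1 := congrArg Subtype.val (hab g h)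
  let : CommGroup G := { (inferInstance : Group G) with mul_comm := hab }
  by_cases hex : ∃ a : G, a ≠ 1 ∧ ∃ α : F,
      (PGL2.lift a.1).trace = α + α ∧ (PGL2.lift a.1).det = α * α
  · obtain ⟨a, ha, α, htr, hdet⟩ := hex
    refine Or.inr (Or.inr (exists_mulEquiv_of_forall_pow_eq_one p fun g => Subtype.ext ?_))
    exact PGL2.pow_char_eq_one_of_commute (fun h => ha (Subtype.ext h)) htr hdet (hab' a g)
  by_cases htriv : ∀ g : G, g = 1
  · exact Or.inr (Or.inr (exists_mulEquiv_of_forall_pow_eq_one p fun g => htriv _))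
  obtain ⟨a, ha⟩ := not_forall.1 htriv
  obtain ⟨α, β, htr, hdet⟩ := exists_roots_fin_two (PGL2.lift a.1)
  have hne : α ≠ β := by
    rintro rfl
    exact hex ⟨a, ha, α, htr, hdet⟩
  by_cases hcomm : ∀ g : G, PGL2.lift a.1 * PGL2.lift g.1 = PGL2.lift g.1 * PGL2.lift a.1
  · obtain ⟨f, hf⟩ :=
      PGL2.exists_injective_hom G (fun h => ha (Subtype.ext h)) hne htr hdet hcomm
    have : IsCyclic G := isCyclic_of_injective_ringHom f hf
    refine Or.inl ⟨Nat.card G, coprime_card_of_forall_pow_eq_one p fun g hg => hf ?_,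
      ⟨(zmodCyclicMulEquiv this).symm⟩⟩
    have h1 : (f g - 1) ^ p = 0 := by
      rw [sub_pow_char, ← map_pow, hg, map_one, one_pow, sub_self]
    rw [map_one]
    exact sub_eq_zero.1 (eq_zero_of_pow_eq_zero h1)
  · obtain ⟨b, hb⟩ := not_forall.1 hcomm
    obtain ⟨h, hta, htb⟩ := (PGL2.lift_mul_lift_of_commute (hab' a b)).resolve_left hb
    have h2 : (2 : F) ≠ 0 := by
      intro h20
      apply hb
      rw [h, neg_eq_iff_add_eq_zero, ← two_smul F, h20, zero_smul]
    have := PGL2.isKleinFour_of_anticommute G hab h2 h hta htb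
    refine Or.inr (Or.inl ⟨?_, ?_⟩)
    · rintro rfl
      exact h2 (by exact_mod_cast CharP.cast_eq_zero F 2)
    · obtain ⟨e⟩ := IsKleinFour.nonempty_mulEquiv (G₁ := G)
        (G₂ := Multiplicative (ZMod 2 × ZMod 2))
      exact ⟨e.trans (MulEquiv.prodMultiplicative _ _)⟩
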